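/- arXiv:1601.07227 — 4 statements merged into one kernel-verified Lean document; each statement's English description precedes it below -/
import Mathlib

section
/- (Winograd) There do not exist linear functionals f_j, g_j : ℝ^{2×2} → ℝ and matrices H_j ∈ ℝ^{2×2} for j = 1, …, 6 such that for all 2×2 real matrices A and B: A·B = Σ_{j=1}^6 f_j(A) g_j(B) H_j. Together with Strassen's 7-term algorithm this shows that the 2×2 matrix multiplication tensor M₂ has rank exactly 7. -/
open Matrix

namespace BilinearRank

/-- The space of `2 × 2` real matrices. -/
abbrev Mat₂ := Matrix (Fin 2) (Fin 2) ℝ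

lemma exists_smul_eq_of_cross_eq_zero {u u' : Fin 2 → ℝ} (hu : u ≠ 0)
    (h : u 0 * u' 1 = u 1 * u' 0) : ∃ t : ℝ, u' = t • u := by
  by_cases h0 : u 0 = 0
  · have h1 : u 1 ≠ 0 := fun h1 => hu (by ext i; fin_cases i <;> simp [h0, h1])
    refine ⟨u' 1 / u 1, ?_⟩
    have : u' 0 = 0 := by simpa [h0, h1] using h
    ext i; fin_cases i <;> simp [h0, h1, this]
  · refine ⟨u' 0 / u 0, ?_⟩
    ext i; fin_cases i
    · simp [h0]
    · simp only [Fin.mk_one, Pi.smul_apply, smul_eq_mul]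
      field_simp
      linarith

/-- The left kernel of a nonzero `2 × 2` matrix is at most one-dimensional. -/
lemma exists_smul_eq_of_vecMul_eq_zero {H : Mat₂} (hH : H ≠ 0) {u u' : Fin 2 → ℝ} (hu : u ≠ 0)
    (h : u ᵥ* H = 0) (h' : u' ᵥ* H = 0) : ∃ t : ℝ, u' = t • u := by
  refine exists_smul_eq_of_cross_eq_zero hu ?_
  by_contra hc
  refine hH ?_
  have hc' : u 0 * u' 1 - u 1 * u' 0 ≠ 0 := sub_ne_zero.2 hc
  have key : ∀ l, H 0 l = 0 ∧ H 1 l = 0 := by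
    intro l
    have e := congrFun h l
    have e' := congrFun h' l
    simp only [vecMul, dotProduct, Fin.sum_univ_two, Pi.zero_apply] at e e'
    constructor <;> refine (mul_eq_zero.1 ?_).resolve_left hc'
    · linear_combination u' 1 * e - u 1 * e'
    · linear_combination u 0 * e' - u' 0 * e
  ext i l
  fin_cases i
  · exact (key l).1
  · exact (key l).2

/-- The vectors `v` for which a nonzero functional vanishes on all `v wᵀ` form an at most
one-dimensional space. -/
lemma exists_smul_eq_of_map_vecMulVec_eq_zero {g : Mat₂ →ₗ[ℝ] ℝ} (hg : g ≠ 0) {v v' : Fin 2 → ℝ}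
    (hv : v ≠ 0) (h : ∀ w, g (vecMulVec v w) = 0) (h' : ∀ w, g (vecMulVec v' w) = 0) :
    ∃ t : ℝ, v' = t • v := by
  let G : Mat₂ := of fun i l => g (Matrix.single i l 1)
  have hG : ∀ v : Fin 2 → ℝ, (∀ w, g (vecMulVec v w) = 0) → v ᵥ* G = 0 := by
    intro v h
    ext l
    have e : vecMulVec v (Pi.single l 1) = ∑ i, v i • Matrix.single i l (1 : ℝ) := by
      ext a b
      fin_cases a <;> fin_cases l <;> fin_cases b <;>
        simp [vecMulVec_apply]
    have := h (Pi.single l 1)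
    simp only [e, map_sum, map_smul, smul_eq_mul] at this
    exact this
  refine exists_smul_eq_of_vecMul_eq_zero (H := G) (fun h0 => hg ?_) hv (hG v h) (hG v' h')
  refine Matrix.ext_linearMap (R := ℝ) fun i l => LinearMap.ext_ring ?_
  simpa [G] using congrFun (congrFun h0 i) l

/-- Left multiplication by a nonzero matrix does not have rank one. -/
lemma not_forall_mul_eq_smul {A : Mat₂} (hA : A ≠ 0) (p : Mat₂ → ℝ) (K : Mat₂) :
    ¬ ∀ B, A * B = p B • K := by
  intro h
  obtain ⟨i, k, hik⟩ : ∃ i k, A i k ≠ 0 := by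
    by_contra! hc
    exact hA (by ext i k; exact hc i k)
  have e : ∀ l m, (if l = m then A i k else 0) = p (Matrix.single k l 1) * K i m := by
    intro l m
    have := congrFun (congrFun (h (Matrix.single k l 1)) i) m
    rw [Matrix.smul_apply, smul_eq_mul] at this
    rw [← this, Matrix.mul_apply]
    fin_cases k <;> simp [Matrix.single_apply]
  have e00 := e 0 0
  have e01 := e 0 1
  have e11 := e 1 1
  simp only [if_true, Fin.zero_eq_one_iff, OfNat.ofNat_ne_one, if_false] at e00 e01 e11
  rcases mul_eq_zero.1 e01.symm with h0 | h0
  · exact hik (by rw [e00, h0, zero_mul])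
  · exact hik (by rw [e11, h0, mul_zero])

/-- If left multiplication by `A ≠ 0` is a sum of three rank-one maps, then `A` shares a left
kernel vector with the image of the second one or a right kernel vector with the functional of the
third one. -/
lemma exists_common_kernel {A : Mat₂} (hA : A ≠ 0) (p g g' : Mat₂ →ₗ[ℝ] ℝ) (P H H' : Mat₂)
    (α β : ℝ) (h : ∀ B, A * B = p B • P + α • (g B • H) + β • (g' B • H')) :
    (∃ u : Fin 2 → ℝ, u ≠ 0 ∧ u ᵥ* A = 0 ∧ u ᵥ* H = 0) ∨
      ∃ v : Fin 2 → ℝ, v ≠ 0 ∧ A *ᵥ v = 0 ∧ ∀ w, g' (vecMulVec v w) = 0 := by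
  have hdet : A.det = 0 := by
    by_contra hdet
    obtain ⟨B, hB, hB0⟩ : ∃ B ∈ LinearMap.ker (LinearMap.pi ![p, g, g']), B ≠ 0 := by
      refine (Submodule.ne_bot_iff _).1 (LinearMap.ker_ne_bot_of_finrank_lt ?_)
      simp [Module.finrank_matrix]
    have hB' := fun i => congrFun (LinearMap.mem_ker.1 hB) i
    have h0 := hB' 0
    have h1 := hB' 1
    have h2 := hB' 2
    simp only [LinearMap.pi_apply, cons_val, Pi.zero_apply] at h0 h1 h2
    have hAB : A * B = 0 := by rw [h, h0, h1, h2]; simp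
    refine hB0 ?_
    rw [← Matrix.nonsing_inv_mul_cancel_left A B (isUnit_iff_ne_zero.2 hdet), hAB, Matrix.mul_zero]
  obtain ⟨u, hu, huA⟩ := Matrix.exists_vecMul_eq_zero_iff.2 hdet
  obtain ⟨v, hv, hAv⟩ := Matrix.exists_mulVec_eq_zero_iff.2 hdet
  by_contra! hc
  obtain ⟨w, hw⟩ := hc.2 v hv hAv
  obtain ⟨l, hl⟩ := Function.ne_iff.1 (hc.1 u hu huA)
  set b := (u ᵥ* H) l with hb
  set c := g' (vecMulVec v w) with hcw
  let T : Mat₂ → Mat₂ := fun B => B - (g' B / c) • vecMulVec v w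
  have hT : ∀ B, A * B = p (T B) • P + α • (g (T B) • H) := by
    intro B
    have h1 : A * T B = A * B := by
      simp [T, Matrix.mul_sub, Matrix.mul_vecMulVec, hAv]
    have h2 : g' (T B) = 0 := by
      simp only [T, map_sub, map_smul, smul_eq_mul, ← hcw]
      field_simp
      ring
    rw [← h1, h (T B), h2]
    simp
  have hg : ∀ B, α * g (T B) = - p (T B) * ((u ᵥ* P) l / b) := by
    intro B
    have h1 : (u ᵥ* (A * B)) l = 0 := by
      rw [← Matrix.vecMul_vecMul, huA, Matrix.zero_vecMul, Pi.zero_apply]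
    rw [hT, Matrix.vecMul_add, Matrix.vecMul_smul, Matrix.vecMul_smul, Matrix.vecMul_smul] at h1
    simp only [Pi.add_apply, Pi.smul_apply, smul_eq_mul, ← hb] at h1
    have hb0 : b ≠ 0 := hl
    field_simp
    linarith
  refine not_forall_mul_eq_smul hA (fun B => p (T B)) (P - ((u ᵥ* P) l / b) • H) fun B => ?_
  rw [hT, smul_smul, hg, smul_sub, smul_smul, neg_mul, neg_smul, sub_eq_add_neg]

lemma exists_smul_eq_matrix_ne_zero (g : Mat₂ →ₗ[ℝ] ℝ) (H : Mat₂) :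
    ∃ (g' : Mat₂ →ₗ[ℝ] ℝ) (H' : Mat₂), H' ≠ 0 ∧ ∀ B, g B • H = g' B • H' := by
  by_cases hH : H = 0
  · exact ⟨0, 1, one_ne_zero, by simp [hH]⟩
  · exact ⟨g, H, hH, fun _ => rfl⟩

lemma exists_smul_eq_functional_ne_zero (g : Mat₂ →ₗ[ℝ] ℝ) (H : Mat₂) :
    ∃ (g' : Mat₂ →ₗ[ℝ] ℝ) (H' : Mat₂), g' ≠ 0 ∧ ∀ B, g B • H = g' B • H' := by
  by_cases hg : g = 0
  · refine ⟨Matrix.traceLinearMap (Fin 2) ℝ ℝ, 0, fun h => ?_, by simp [hg]⟩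
    have := LinearMap.congr_fun h 1
    simp at this
  · exact ⟨g, H, hg, fun _ => rfl⟩

/-- If left multiplication by each `A k` is a rank-one map plus a combination of two fixed rank-one
maps, then a nonzero form `A ↦ u ⬝ A v` vanishes on all the `A k`. -/
lemma exists_dotProduct_mulVec_eq_zero {κ : Type*} (A : κ → Mat₂) (p : κ → Mat₂ →ₗ[ℝ] ℝ)
    (P : κ → Mat₂) (α β : κ → ℝ) (g g' : Mat₂ →ₗ[ℝ] ℝ) (H H' : Mat₂) (hA : ∀ k, A k ≠ 0)
    (h : ∀ k B, A k * B = p k B • P k + α k • (g B • H) + β k • (g' B • H')) :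
    ∃ u v : Fin 2 → ℝ, u ≠ 0 ∧ v ≠ 0 ∧ ∀ k, u ⬝ᵥ A k *ᵥ v = 0 := by
  obtain ⟨g₁, H₁, hH₁, e₁⟩ := exists_smul_eq_matrix_ne_zero g H
  obtain ⟨g₂, H₂, hg₂, e₂⟩ := exists_smul_eq_functional_ne_zero g' H'
  simp only [e₁, e₂] at h
  obtain ⟨u, hu, hu'⟩ : ∃ u : Fin 2 → ℝ, u ≠ 0 ∧
      ∀ u', u' ≠ 0 → u' ᵥ* H₁ = 0 → ∃ t : ℝ, u = t • u' := by
    by_cases hex : ∃ u : Fin 2 → ℝ, u ≠ 0 ∧ u ᵥ* H₁ = 0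
    · obtain ⟨u, hu, huH⟩ := hex
      exact ⟨u, hu, fun u' h0 h1 => exists_smul_eq_of_vecMul_eq_zero hH₁ h0 h1 huH⟩
    · push Not at hex
      exact ⟨1, one_ne_zero, fun u' h0 h1 => absurd h1 (hex u' h0)⟩
  obtain ⟨v, hv, hv'⟩ : ∃ v : Fin 2 → ℝ, v ≠ 0 ∧
      ∀ v', v' ≠ 0 → (∀ w, g₂ (vecMulVec v' w) = 0) → ∃ t : ℝ, v = t • v' := by
    by_cases hex : ∃ v : Fin 2 → ℝ, v ≠ 0 ∧ ∀ w, g₂ (vecMulVec v w) = 0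
    · obtain ⟨v, hv, hvg⟩ := hex
      exact ⟨v, hv, fun v' h0 h1 => exists_smul_eq_of_map_vecMulVec_eq_zero hg₂ h0 h1 hvg⟩
    · exact ⟨1, one_ne_zero, fun v' h0 h1 => absurd ⟨v', h0, h1⟩ hex⟩
  refine ⟨u, v, hu, hv, fun k => ?_⟩
  rcases exists_common_kernel (hA k) _ _ _ _ _ _ _ _ (h k) with ⟨u', h0, h1, h2⟩ | ⟨v', h0, h1, h2⟩
  · obtain ⟨t, rfl⟩ := hu' u' h0 h2
    rw [Matrix.dotProduct_mulVec, Matrix.smul_vecMul, h1, smul_zero, zero_dotProduct]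
  · obtain ⟨t, rfl⟩ := hv' v' h0 h2
    rw [Matrix.mulVec_smul, h1, smul_zero, dotProduct_zero]

/-- From a finite family of functionals separating the points of `V` one can select
coordinates on `V`. -/
lemma exists_coordinates {ι V : Type*} [Finite ι] [AddCommGroup V] [Module ℝ V]
    [FiniteDimensional ℝ V] (f : ι → V →ₗ[ℝ] ℝ) (hf : ∀ x, (∀ j, f j x = 0) → x = 0) :
    ∃ (a : Fin (Module.finrank ℝ V) → ι) (F : V ≃ₗ[ℝ] (Fin (Module.finrank ℝ V) → ℝ)),
      Function.Injective a ∧ ∀ x k, F x k = f (a k) x := by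
  obtain ⟨κ, a, ha, hspan, hli⟩ := exists_linearIndependent' ℝ f
  have : Finite κ := Finite.of_injective a ha
  have := Fintype.ofFinite κ
  have hinj : Function.Injective (LinearMap.pi fun k => f (a k)) := by
    refine (injective_iff_map_eq_zero _).2 fun x hx => hf x fun j => ?_
    have hle : Submodule.span ℝ (Set.range f) ≤
        LinearMap.ker (LinearMap.applyₗ x : (V →ₗ[ℝ] ℝ) →ₗ[ℝ] ℝ) := by
      rw [← hspan, Submodule.span_le]
      rintro _ ⟨k, rfl⟩
      exact congrFun hx k
    exact hle (Submodule.subset_span ⟨j, rfl⟩)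
  have hcard : Fintype.card κ = Module.finrank ℝ V := by
    refine le_antisymm ?_ ?_
    · simpa [Subspace.dual_finrank_eq] using
        LinearIndependent.fintype_card_le_finrank (M := Module.Dual ℝ V) hli
    · simpa using LinearMap.finrank_le_finrank_of_injective hinj
  let e : Fin (Module.finrank ℝ V) ≃ κ := (Fintype.equivFinOfCardEq hcard).symm
  refine ⟨a ∘ e, (LinearEquiv.ofInjectiveOfFinrankEq _ hinj (by simpa using hcard.symm)).trans
    (LinearEquiv.funCongrLeft ℝ ℝ e), ha.comp e.injective, fun x k => ?_⟩
  rfl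

end BilinearRank

open BilinearRank

/-- Winograd: there is no exact rank-6 bilinear algorithm for 2×2 matrix
multiplication; the 2×2 matrix multiplication tensor has rank exactly 7. -/
theorem winograd_no_rank_six :
    ¬ ∃ (f g : Fin 6 → (Matrix (Fin 2) (Fin 2) ℝ) →ₗ[ℝ] ℝ)
        (H : Fin 6 → Matrix (Fin 2) (Fin 2) ℝ),
        ∀ A B : Matrix (Fin 2) (Fin 2) ℝ,
          A * B = ∑ j, (f j A * g j B) • H j := by
  rintro ⟨f, g, H, h⟩
  obtain ⟨a, F, ha, hF⟩ := exists_coordinates f fun x hx => by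
    rw [← Matrix.mul_one x, h]
    simp [hx]
  have hdim : Module.finrank ℝ Mat₂ = 4 := by simp [Module.finrank_matrix]
  let s : Finset (Fin 6) := Finset.univ.image a
  have hs : sᶜ.card = 2 := by
    rw [Finset.card_compl, Finset.card_image_of_injective _ ha]
    simp [hdim]
  obtain ⟨c, d, hcd, hsc⟩ := Finset.card_eq_two.1 hs
  let X := fun k => F.symm (Pi.single k 1)
  have hX : ∀ k i, f (a i) (X k) = (Pi.single k 1 : _ → ℝ) i := fun k i => by
    rw [← hF, LinearEquiv.apply_symm_apply]
  obtain ⟨u, v, hu, hv, huv⟩ := exists_dotProduct_mulVec_eq_zero X (fun k => g (a k))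
    (fun k => H (a k)) (fun k => f c (X k)) (fun k => f d (X k)) (g c) (g d) (H c) (H d)
    (fun k => by simp [X]) fun k B => by
      rw [h, ← Finset.sum_add_sum_compl s, hsc, Finset.sum_pair hcd,
        Finset.sum_image ha.injOn, Finset.sum_eq_single k]
      · simp [hX, mul_smul, add_assoc]
      · intro i _ hi
        simp [hX, hi]
      · simp
  let φ : Mat₂ →ₗ[ℝ] ℝ :=
    { toFun := fun A => u ⬝ᵥ A *ᵥ v
      map_add' := fun A B => by rw [Matrix.add_mulVec, dotProduct_add]
      map_smul' := fun t A => by rw [Matrix.smul_mulVec, dotProduct_smul, RingHom.id_apply] }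
  have hφ : φ ∘ₗ F.symm.toLinearMap = 0 :=
    LinearMap.pi_ext' fun k => LinearMap.ext_ring (huv k)
  obtain ⟨i, hi⟩ := Function.ne_iff.1 hu
  obtain ⟨l, hl⟩ := Function.ne_iff.1 hv
  have h0 : u ⬝ᵥ Matrix.single i l (1 : ℝ) *ᵥ v = 0 := by
    simpa [φ] using LinearMap.congr_fun hφ (F (Matrix.single i l 1))
  refine mul_ne_zero hi hl ?_
  rw [Matrix.single_mulVec] at h0
  fin_cases i <;> simpa using h0
end

section
/- (Laderman) There exist linear functionals f_j, g_j : ℝ^{3×3} → ℝ and matrices H_j ∈ ℝ^{3×3} for j = 1, …, 23 such that for all 3×3 real matrices A and B: A·B = Σ_{j=1}^{23} f_j(A) g_j(B) H_j. Hence the 3×3 matrix multiplication tensor M₃ has rank at most 23. -/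
open Matrix

/-- The linear functional `X ↦ ∑ i k, M i k * X i k` on matrices with coefficient matrix `M`. -/
def coeffFunctional (M : Matrix (Fin 3) (Fin 3) ℝ) : Matrix (Fin 3) (Fin 3) ℝ →ₗ[ℝ] ℝ :=
  ∑ i, ∑ k, M i k • entryLinearMap ℝ ℝ i k

theorem coeffFunctional_apply (M X : Matrix (Fin 3) (Fin 3) ℝ) :
    coeffFunctional M X = ∑ i, ∑ k, M i k * X i k := by
  simp [coeffFunctional]

/-- Coefficients of the left factors in the 23 products of Laderman. -/
noncomputable def ladermanLeft : Fin 23 → Matrix (Fin 3) (Fin 3) ℝ :=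
  ![!![1, 1, 1; -1, -1, 0; 0, -1, -1],
    !![1, 0, 0; -1, 0, 0; 0, 0, 0],
    !![0, 0, 0; 0, 1, 0; 0, 0, 0],
    !![-1, 0, 0; 1, 1, 0; 0, 0, 0],
    !![0, 0, 0; 1, 1, 0; 0, 0, 0],
    !![1, 0, 0; 0, 0, 0; 0, 0, 0],
    !![-1, 0, 0; 0, 0, 0; 1, 1, 0],
    !![-1, 0, 0; 0, 0, 0; 1, 0, 0],
    !![0, 0, 0; 0, 0, 0; 1, 1, 0],
    !![1, 1, 1; 0, -1, -1; -1, -1, 0],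
    !![0, 0, 0; 0, 0, 0; 0, 1, 0],
    !![0, 0, -1; 0, 0, 0; 0, 1, 1],
    !![0, 0, 1; 0, 0, 0; 0, 0, -1],
    !![0, 0, 1; 0, 0, 0; 0, 0, 0],
    !![0, 0, 0; 0, 0, 0; 0, 1, 1],
    !![0, 0, -1; 0, 1, 1; 0, 0, 0],
    !![0, 0, 1; 0, 0, -1; 0, 0, 0],
    !![0, 0, 0; 0, 1, 1; 0, 0, 0],
    !![0, 1, 0; 0, 0, 0; 0, 0, 0],
    !![0, 0, 0; 0, 0, 1; 0, 0, 0],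
    !![0, 0, 0; 1, 0, 0; 0, 0, 0],
    !![0, 0, 0; 0, 0, 0; 1, 0, 0],
    !![0, 0, 0; 0, 0, 0; 0, 0, 1]]

/-- Coefficients of the right factors in the 23 products of Laderman. -/
noncomputable def ladermanRight : Fin 23 → Matrix (Fin 3) (Fin 3) ℝ :=
  ![!![0, 0, 0; 0, 1, 0; 0, 0, 0],
    !![0, -1, 0; 0, 1, 0; 0, 0, 0],
    !![-1, 1, 0; 1, -1, -1; -1, 0, 1],
    !![1, -1, 0; 0, 1, 0; 0, 0, 0],
    !![-1, 1, 0; 0, 0, 0; 0, 0, 0],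
    !![1, 0, 0; 0, 0, 0; 0, 0, 0],
    !![1, 0, -1; 0, 0, 1; 0, 0, 0],
    !![0, 0, 1; 0, 0, -1; 0, 0, 0],
    !![-1, 0, 1; 0, 0, 0; 0, 0, 0],
    !![0, 0, 0; 0, 0, 1; 0, 0, 0],
    !![-1, 0, 1; 1, -1, -1; -1, 1, 0],
    !![0, 0, 0; 0, 1, 0; 1, -1, 0],
    !![0, 0, 0; 0, 1, 0; 0, -1, 0],
    !![0, 0, 0; 0, 0, 0; 1, 0, 0],
    !![0, 0, 0; 0, 0, 0; -1, 1, 0],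
    !![0, 0, 0; 0, 0, 1; 1, 0, -1],
    !![0, 0, 0; 0, 0, 1; 0, 0, -1],
    !![0, 0, 0; 0, 0, 0; -1, 0, 1],
    !![0, 0, 0; 1, 0, 0; 0, 0, 0],
    !![0, 0, 0; 0, 0, 0; 0, 1, 0],
    !![0, 0, 1; 0, 0, 0; 0, 0, 0],
    !![0, 1, 0; 0, 0, 0; 0, 0, 0],
    !![0, 0, 0; 0, 0, 0; 0, 0, 1]]

/-- Entries of the product matrix to which each of the 23 products of Laderman contributes. -/
noncomputable def ladermanOutput : Fin 23 → Matrix (Fin 3) (Fin 3) ℝ :=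
  ![!![0, 1, 0; 0, 0, 0; 0, 0, 0],
    !![0, 0, 0; 1, 1, 0; 0, 0, 0],
    !![0, 0, 0; 1, 0, 0; 0, 0, 0],
    !![0, 1, 0; 1, 1, 0; 0, 0, 0],
    !![0, 1, 0; 0, 1, 0; 0, 0, 0],
    !![1, 1, 1; 1, 1, 0; 1, 0, 1],
    !![0, 0, 1; 0, 0, 0; 1, 0, 1],
    !![0, 0, 0; 0, 0, 0; 1, 0, 1],
    !![0, 0, 1; 0, 0, 0; 0, 0, 1],
    !![0, 0, 1; 0, 0, 0; 0, 0, 0],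
    !![0, 0, 0; 0, 0, 0; 1, 0, 0],
    !![0, 1, 0; 0, 0, 0; 1, 1, 0],
    !![0, 0, 0; 0, 0, 0; 1, 1, 0],
    !![1, 1, 1; 1, 0, 1; 1, 1, 0],
    !![0, 1, 0; 0, 0, 0; 0, 1, 0],
    !![0, 0, 1; 1, 0, 1; 0, 0, 0],
    !![0, 0, 0; 1, 0, 1; 0, 0, 0],
    !![0, 0, 1; 0, 0, 1; 0, 0, 0],
    !![1, 0, 0; 0, 0, 0; 0, 0, 0],
    !![0, 0, 0; 0, 1, 0; 0, 0, 0],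
    !![0, 0, 0; 0, 0, 1; 0, 0, 0],
    !![0, 0, 0; 0, 0, 0; 0, 1, 0],
    !![0, 0, 0; 0, 0, 0; 0, 0, 1]]

/-- Laderman: there is an exact rank-23 bilinear algorithm for 3×3 matrix
multiplication; the 3×3 matrix multiplication tensor has rank at most 23. -/
theorem laderman_rank_at_most_23 :
    ∃ (f g : Fin 23 → (Matrix (Fin 3) (Fin 3) ℝ) →ₗ[ℝ] ℝ)
      (H : Fin 23 → Matrix (Fin 3) (Fin 3) ℝ),
      ∀ A B : Matrix (Fin 3) (Fin 3) ℝ,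
        A * B = ∑ j, (f j A * g j B) • H j := by
  refine ⟨fun j => coeffFunctional (ladermanLeft j), fun j => coeffFunctional (ladermanRight j),
    ladermanOutput, fun A B => ?_⟩
  ext i k
  simp only [Matrix.sum_apply, Matrix.smul_apply, smul_eq_mul, coeffFunctional_apply, mul_apply,
    Fin.sum_univ_succ, Fin.sum_univ_zero]
  fin_cases i <;> fin_cases k <;>
    simp [ladermanLeft, ladermanRight, ladermanOutput] <;> ring
end

section
/- (Border rank of M₂ equals its rank) There exists δ > 0 such that for every choice of matrices W_a, W_b ∈ ℝ^{6×4} and W_c ∈ ℝ^{4×6}, the squared decomposition error of the 2×2 matrix multiplication tensor satisfies Σ_{i,k,l=1}^{4} ( M₂(i,k,l) − Σ_{j=1}^{6} W_c(i,j) W_a(j,k) W_b(j,l) )² ≥ δ. In other words, M₂ cannot even be approximated arbitrarily well by tensors of rank at most 6: it has no lower-rank border approximations. -/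
open Matrix

/-- The `n×n` matrix multiplication tensor on double indices:
`M_n((i,i'),(k,k'),(l,l')) = 1` iff `i = k`, `k' = l`, `l' = i'`. -/
def matMulTensor (n : ℕ) :
    (Fin n × Fin n) → (Fin n × Fin n) → (Fin n × Fin n) → ℝ :=
  fun i k l => if i.1 = k.1 ∧ k.2 = l.1 ∧ l.2 = i.2 then 1 else 0

section TracelessPart

open Module Submodule

/-- The projection `U* ⊗ V ⊗ V* ⊗ W → U* ⊗ sl(V) ⊗ W`; the middle factor of the target is written
in the coordinates `(N₀₁, N₀₀ - N₁₁, N₁₀)` of the traceless part of `N`. -/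
def tracelessPart :
    ((Fin 2 × Fin 2) × (Fin 2 × Fin 2) → ℝ) →ₗ[ℝ] (Fin 2 → Fin 3 × Fin 2 → ℝ) where
  toFun m u p := ![m ((u, 0), (1, p.2)), m ((u, 0), (0, p.2)) - m ((u, 1), (1, p.2)),
    m ((u, 1), (0, p.2))] p.1
  map_add' m m' := by
    ext u ⟨s, w⟩
    fin_cases s <;> simp
    ring
  map_smul' c m := by
    ext u ⟨s, w⟩
    fin_cases s <;> simp
    ring

/-- Multiplication of (vector-valued) binary quadratic forms `-p₀ x² + p₁ x y + p₂ y²` by the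
variable `x`, with values in binary cubic forms. -/
def mulFstVar : (Fin 3 × Fin 2 → ℝ) →ₗ[ℝ] (Fin 4 × Fin 2 → ℝ) where
  toFun g p := ![-g (0, p.2), g (1, p.2), g (2, p.2), 0] p.1
  map_add' g g' := by
    ext ⟨s, w⟩
    fin_cases s <;> simp
    ring
  map_smul' c g := by
    ext ⟨s, w⟩
    fin_cases s <;> simp

/-- Multiplication of (vector-valued) binary quadratic forms `-p₀ x² + p₁ x y + p₂ y²` by the
variable `y`, with values in binary cubic forms. -/
def mulSndVar : (Fin 3 × Fin 2 → ℝ) →ₗ[ℝ] (Fin 4 × Fin 2 → ℝ) where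
  toFun g p := ![0, -g (0, p.2), g (1, p.2), g (2, p.2)] p.1
  map_add' g g' := by
    ext ⟨s, w⟩
    fin_cases s <;> simp
    ring
  map_smul' c g := by
    ext ⟨s, w⟩
    fin_cases s <;> simp

theorem mulFstVar_injective : Function.Injective mulFstVar := by
  intro g g' h
  ext ⟨s, w⟩
  have h0 := congrFun h (0, w)
  have h1 := congrFun h (1, w)
  have h2 := congrFun h (2, w)
  simp [mulFstVar] at h0 h1 h2
  fin_cases s <;> simp [h0, h1, h2]

theorem mulSndVar_injective : Function.Injective mulSndVar := by
  intro g g' h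
  ext ⟨s, w⟩
  have h0 := congrFun h (1, w)
  have h1 := congrFun h (2, w)
  have h2 := congrFun h (3, w)
  simp [mulSndVar] at h0 h1 h2
  fin_cases s <;> simp [h0, h1, h2]

theorem eq_bot_of_map_mulFstVar_le_map_mulSndVar (G : Submodule ℝ (Fin 3 × Fin 2 → ℝ))
    (h : G.map mulFstVar ≤ G.map mulSndVar) : G = ⊥ := by
  have key : ∀ g ∈ G, ∃ g' ∈ G, mulSndVar g' = mulFstVar g := fun g hg =>
    h (mem_map_of_mem hg)
  have h0 : ∀ g ∈ G, ∀ w, g (0, w) = 0 := by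
    intro g hg w
    obtain ⟨g', hg', e⟩ := key g hg
    have := congrFun e (0, w)
    simpa [mulFstVar, mulSndVar] using this
  have h1 : ∀ g ∈ G, ∀ w, g (1, w) = 0 := by
    intro g hg w
    obtain ⟨g', hg', e⟩ := key g hg
    have := congrFun e (1, w)
    simpa [mulFstVar, mulSndVar, h0 g' hg'] using this.symm
  have h2 : ∀ g ∈ G, ∀ w, g (2, w) = 0 := by
    intro g hg w
    obtain ⟨g', hg', e⟩ := key g hg
    have := congrFun e (2, w)
    simpa [mulFstVar, mulSndVar, h1 g' hg'] using this.symm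
  rw [eq_bot_iff]
  intro g hg
  rw [mem_bot]
  ext ⟨s, w⟩
  fin_cases s
  · exact h0 g hg w
  · exact h1 g hg w
  · exact h2 g hg w

theorem finrank_le_one_of_mulVar_mem (G : Submodule ℝ (Fin 3 × Fin 2 → ℝ))
    (R : Submodule ℝ (Fin 4 × Fin 2 → ℝ)) (hR : finrank ℝ R ≤ 2)
    (hx : ∀ g ∈ G, mulFstVar g ∈ R) (hy : ∀ g ∈ G, mulSndVar g ∈ R) : finrank ℝ G ≤ 1 := by
  by_contra! hG
  have ex : G.map mulFstVar = R := eq_of_le_of_finrank_le (map_le_iff_le_comap.2 hx) <| by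
    rw [← (equivMapOfInjective _ mulFstVar_injective G).finrank_eq]
    lia
  have ey : G.map mulSndVar = R := eq_of_le_of_finrank_le (map_le_iff_le_comap.2 hy) <| by
    rw [← (equivMapOfInjective _ mulSndVar_injective G).finrank_eq]
    lia
  rw [eq_bot_of_map_mulFstVar_le_map_mulSndVar G (ex.trans ey.symm).le] at hG
  simp at hG

/-- The multiplication map `(U* ⊗ V) ⊗ (U* ⊗ S²V ⊗ W) → Λ²U* ⊗ S³V ⊗ W`. -/
def wedgeMul :
    (Fin 2 × Fin 2 → Fin 2 → Fin 3 × Fin 2 → ℝ) →ₗ[ℝ] (Fin 4 × Fin 2 → ℝ) where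
  toFun Z := mulFstVar (Z (0, 0) 1 - Z (1, 0) 0) + mulSndVar (Z (0, 1) 1 - Z (1, 1) 0)
  map_add' Z Z' := by
    simp only [Pi.add_apply, map_add, map_sub]
    abel
  map_smul' c Z := by
    simp only [Pi.smul_apply, map_smul, map_sub, RingHom.id_apply, smul_add, smul_sub]

theorem wedgeMul_tracelessPart_eq_zero (X : Fin 2 × Fin 2 → (Fin 2 × Fin 2) × (Fin 2 × Fin 2) → ℝ)
    (hX : ∀ a a' b, X a (a', b) = X a' (a, b)) :
    wedgeMul (fun a => tracelessPart (X a)) = 0 := by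
  ext ⟨s, w⟩
  have h := fun v v' b => hX (0, v) (1, v') b
  fin_cases s <;> simp [wedgeMul, mulFstVar, mulSndVar, tracelessPart, h]

theorem eq_zero_of_tracelessPart_eq_zero
    (X : Fin 2 × Fin 2 → (Fin 2 × Fin 2) × (Fin 2 × Fin 2) → ℝ)
    (hX : ∀ a a' b, X a (a', b) = X a' (a, b)) (h : ∀ a, tracelessPart (X a) = 0) : X = 0 := by
  have h0 : ∀ a u w, X a ((u, 0), (1, w)) = 0 := fun a u w => by
    simpa [tracelessPart] using congrFun (congrFun (h a) u) (0, w)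
  have h1 : ∀ a u w, X a ((u, 0), (0, w)) = X a ((u, 1), (1, w)) := fun a u w => by
    simpa [tracelessPart, sub_eq_zero] using congrFun (congrFun (h a) u) (1, w)
  have h2 : ∀ a u w, X a ((u, 1), (0, w)) = 0 := fun a u w => by
    simpa [tracelessPart] using congrFun (congrFun (h a) u) (2, w)
  ext ⟨u, v⟩ ⟨⟨u', v'⟩, ⟨v'', w⟩⟩
  fin_cases v <;> fin_cases v' <;> fin_cases v'' <;> simp [h0, h2]
  · rw [h1, hX, h0]
  · rw [hX, h0]
  · rw [hX, h2]
  · rw [← h1, hX, h2]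

/-- If `E` has two-dimensional image in `U* ⊗ sl(V) ⊗ W` and `(A ⊗ E) ∩ (S²A ⊗ B)` has dimension at
least six, then this image lies in `U* ⊗ g` for a single `g`. -/
theorem exists_tracelessPart_eq_of_finrank_symm
    (E : Submodule ℝ ((Fin 2 × Fin 2) × (Fin 2 × Fin 2) → ℝ))
    (hE : finrank ℝ (E.map tracelessPart) ≤ 2)
    (P : Submodule ℝ (Fin 2 × Fin 2 → (Fin 2 × Fin 2) × (Fin 2 × Fin 2) → ℝ))
    (hP : 6 ≤ finrank ℝ P) (hPE : ∀ X ∈ P, ∀ a, X a ∈ E)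
    (hsymm : ∀ X ∈ P, ∀ a a' b, X a (a', b) = X a' (a, b)) :
    ∃ g : Fin 3 × Fin 2 → ℝ, ∀ m ∈ E, ∃ α : Fin 2 → ℝ,
      ∀ u p, tracelessPart m u p = α u * g p := by
  set F := E.map tracelessPart
  let ι : (Fin 2 × Fin 2 → F) →ₗ[ℝ] (Fin 2 × Fin 2 → Fin 2 → Fin 3 × Fin 2 → ℝ) :=
    F.subtype.compLeft _
  let μ := wedgeMul ∘ₗ ι
  let j : P →ₗ[ℝ] (Fin 2 × Fin 2 → F) :=
    { toFun := fun X a => ⟨tracelessPart (X.1 a), mem_map_of_mem (hPE X.1 X.2 a)⟩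
      map_add' := fun X Y => by ext a : 2; simp
      map_smul' := fun c X => by ext a : 2; simp }
  have hj : Function.Injective j := by
    rw [← LinearMap.ker_eq_bot, eq_bot_iff]
    intro X hX
    rw [mem_bot]
    ext1
    refine eq_zero_of_tracelessPart_eq_zero _ (hsymm X.1 X.2) fun a => ?_
    exact congrArg Subtype.val (congrFun (LinearMap.mem_ker.1 hX) a)
  have hker : LinearMap.range j ≤ LinearMap.ker μ := by
    rintro _ ⟨X, rfl⟩
    exact wedgeMul_tracelessPart_eq_zero X.1 (hsymm X.1 X.2)
  have h1 := finrank_mono hker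
  rw [LinearMap.finrank_range_of_inj hj] at h1
  have h2 := μ.finrank_range_add_finrank_ker
  have h3 : finrank ℝ (Fin 2 × Fin 2 → F) = 4 * finrank ℝ F := by
    simp [finrank_pi_fintype]
  let G : Submodule ℝ (Fin 3 × Fin 2 → ℝ) := F.map (LinearMap.proj 0) ⊔ F.map (LinearMap.proj 1)
  have hG : ∀ f ∈ F, ∀ u, f u ∈ G := by
    intro f hf u
    fin_cases u
    · exact mem_sup_left (mem_map_of_mem (f := LinearMap.proj 0) hf)
    · exact mem_sup_right (mem_map_of_mem (f := LinearMap.proj 1) hf)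
  have hx : ∀ g ∈ G, mulFstVar g ∈ LinearMap.range μ := by
    change G ≤ (LinearMap.range μ).comap mulFstVar
    refine sup_le ?_ ?_ <;> rintro _ ⟨f, hf, rfl⟩
    · exact ⟨-Pi.single (1, 0) ⟨f, hf⟩, by simp [μ, ι, wedgeMul]⟩
    · exact ⟨Pi.single (0, 0) ⟨f, hf⟩, by simp [μ, ι, wedgeMul]⟩
  have hy : ∀ g ∈ G, mulSndVar g ∈ LinearMap.range μ := by
    change G ≤ (LinearMap.range μ).comap mulSndVar
    refine sup_le ?_ ?_ <;> rintro _ ⟨f, hf, rfl⟩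
    · exact ⟨-Pi.single (1, 1) ⟨f, hf⟩, by simp [μ, ι, wedgeMul]⟩
    · exact ⟨Pi.single (0, 1) ⟨f, hf⟩, by simp [μ, ι, wedgeMul]⟩
  obtain ⟨g, hg⟩ := finrank_le_one_iff.1
    (finrank_le_one_of_mulVar_mem G (LinearMap.range μ) (by lia) hx hy)
  refine ⟨g.1, fun m hm => ?_⟩
  choose α hα using fun u => hg ⟨_, hG _ (mem_map_of_mem hm) u⟩
  exact ⟨α, fun u p => (congrFun (congrArg Subtype.val (hα u)) p).symm⟩

/-- No two-dimensional space is contained in both `U* ⊗ g` and `h ⊗ W`. -/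
theorem finrank_ne_two_of_forall_eq_mul (F : Submodule ℝ (Fin 2 → Fin 3 × Fin 2 → ℝ))
    (g : Fin 3 × Fin 2 → ℝ) (hg : ∀ f ∈ F, ∃ α : Fin 2 → ℝ, ∀ u p, f u p = α u * g p)
    (h : Fin 2 → Fin 3 → ℝ)
    (hh : ∀ f ∈ F, ∃ β : Fin 2 → ℝ, ∀ u s w, f u (s, w) = β w * h u s) :
    finrank ℝ F ≠ 2 := by
  intro hF
  let L : (Fin 2 → ℝ) →ₗ[ℝ] (Fin 2 → Fin 3 × Fin 2 → ℝ) :=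
    { toFun := fun α u p => α u * g p
      map_add' := fun α β => by ext; simp [add_mul]
      map_smul' := fun c α => by ext; simp [mul_assoc] }
  have hFL : F = LinearMap.range L := by
    refine eq_of_le_of_finrank_le (fun f hf => ?_) ?_
    · obtain ⟨α, hα⟩ := hg f hf
      exact ⟨α, by ext u p; simp [L, hα]⟩
    · rw [hF]
      simpa using L.finrank_range_le
  have hL : ∀ α, L α ∈ F := fun α => hFL ▸ LinearMap.mem_range_self L α
  obtain ⟨β, hβ⟩ := hh _ (hL ![1, 0])
  obtain ⟨γ, hγ⟩ := hh _ (hL ![0, 1])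
  have e1 : ∀ s w, g (s, w) = β w * h 0 s := fun s w => by simpa [L] using hβ 0 s w
  have e2 : ∀ s w, 0 = β w * h 1 s := fun s w => by simpa [L] using hβ 1 s w
  have e3 : ∀ s w, g (s, w) = γ w * h 1 s := fun s w => by simpa [L] using hγ 1 s w
  have hg0 : g = 0 := by
    ext ⟨s, w⟩
    rcases mul_eq_zero.1 (e2 s w).symm with h0 | h0
    · simp [e1, h0]
    · simp [e3, h0]
  have : L = 0 := LinearMap.ext fun α => funext₂ fun u p => by simp [L, hg0]
  rw [hFL, this, LinearMap.range_zero, finrank_bot] at hF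
  lia

theorem tracelessPart_surjective : Function.Surjective tracelessPart := by
  intro f
  refine ⟨fun q => ![![f q.1.1 (1, q.2.2), f q.1.1 (0, q.2.2)], ![f q.1.1 (2, q.2.2), 0]]
    q.1.2 q.2.1, ?_⟩
  ext u ⟨s, w⟩
  fin_cases s <;> simp [tracelessPart]

theorem finrank_map_tracelessPart (E : Submodule ℝ ((Fin 2 × Fin 2) × (Fin 2 × Fin 2) → ℝ))
    (hE : finrank ℝ E = 6) (hker : LinearMap.ker tracelessPart ≤ E) :
    finrank ℝ (E.map tracelessPart) = 2 := by
  have h1 := tracelessPart.finrank_range_add_finrank_ker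
  have h2 := (tracelessPart.domRestrict E).finrank_range_add_finrank_ker
  rw [LinearMap.range_eq_top.2 tracelessPart_surjective, finrank_top] at h1
  rw [LinearMap.range_domRestrict, LinearMap.ker_domRestrict,
    (comapSubtypeEquivOfLe hker).finrank_eq, hE] at h2
  simp [finrank_pi_fintype] at h1
  lia

/-- Interchanging the two matrix factors by transposing: `m ↦ m'` with
`m'((u, v), (v', w)) = m((w, v'), (v, u))`. -/
def swapFactors : ((Fin 2 × Fin 2) × (Fin 2 × Fin 2) → ℝ) ≃ₗ[ℝ]
    ((Fin 2 × Fin 2) × (Fin 2 × Fin 2) → ℝ) :=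
  LinearEquiv.funCongrLeft ℝ ℝ ((Equiv.prodComm _ _).trans
    (Equiv.prodCongr (Equiv.prodComm _ _) (Equiv.prodComm _ _)))

theorem swapFactors_apply (m : (Fin 2 × Fin 2) × (Fin 2 × Fin 2) → ℝ) (a b : Fin 2 × Fin 2) :
    swapFactors m (a, b) = m (b.swap, a.swap) := rfl

theorem tracelessPart_swapFactors (m : (Fin 2 × Fin 2) × (Fin 2 × Fin 2) → ℝ) (u w : Fin 2)
    (s : Fin 3) : tracelessPart (swapFactors m) u (s, w) = tracelessPart m w (s.rev, u) := by
  fin_cases s <;> simp [tracelessPart, swapFactors_apply]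

theorem ker_tracelessPart_le (E : Submodule ℝ ((Fin 2 × Fin 2) × (Fin 2 × Fin 2) → ℝ))
    (hT : ∀ i, (fun p => matMulTensor 2 i p.1 p.2) ∈ E) :
    LinearMap.ker tracelessPart ≤ E := by
  intro m hm
  have hm' : tracelessPart m = 0 := hm
  have h0 : ∀ u w, m ((u, 0), (1, w)) = 0 := fun u w => by
    simpa [tracelessPart] using congrFun (congrFun hm' u) (0, w)
  have h1 : ∀ u w, m ((u, 0), (0, w)) = m ((u, 1), (1, w)) := fun u w => by
    simpa [tracelessPart, sub_eq_zero] using congrFun (congrFun hm' u) (1, w)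
  have h2 : ∀ u w, m ((u, 1), (0, w)) = 0 := fun u w => by
    simpa [tracelessPart] using congrFun (congrFun hm' u) (2, w)
  have : m = ∑ i : Fin 2 × Fin 2,
      m ((i.1, 0), (0, i.2)) • fun p => matMulTensor 2 i p.1 p.2 := by
    ext ⟨⟨u, v⟩, ⟨v', w⟩⟩
    fin_cases v <;> fin_cases v' <;> fin_cases u <;> fin_cases w <;>
      simp [Fintype.sum_prod_type, matMulTensor, h0, h1, h2]
  rw [this]
  exact sum_mem fun i _ => smul_mem _ _ (hT i)

/-- No six-dimensional `E ⊆ A ⊗ B` containing the slices of `M₂` has both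
`(A ⊗ E) ∩ (S²A ⊗ B)` and `(B ⊗ E) ∩ (A ⊗ S²B)` of dimension at least six. -/
theorem not_six_le_finrank_symm (E : Submodule ℝ ((Fin 2 × Fin 2) × (Fin 2 × Fin 2) → ℝ))
    (hE : finrank ℝ E = 6) (hT : ∀ i, (fun p => matMulTensor 2 i p.1 p.2) ∈ E)
    (P : Submodule ℝ (Fin 2 × Fin 2 → (Fin 2 × Fin 2) × (Fin 2 × Fin 2) → ℝ))
    (hP : 6 ≤ finrank ℝ P) (hPE : ∀ X ∈ P, ∀ a, X a ∈ E)
    (hPsymm : ∀ X ∈ P, ∀ a a' b, X a (a', b) = X a' (a, b))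
    (Q : Submodule ℝ (Fin 2 × Fin 2 → (Fin 2 × Fin 2) × (Fin 2 × Fin 2) → ℝ))
    (hQ : 6 ≤ finrank ℝ Q) (hQE : ∀ Y ∈ Q, ∀ b, Y b ∈ E)
    (hQsymm : ∀ Y ∈ Q, ∀ a b b', Y b (a, b') = Y b' (a, b)) : False := by
  have hker := ker_tracelessPart_le E hT
  have hF := finrank_map_tracelessPart E hE hker
  obtain ⟨g, hg⟩ := exists_tracelessPart_eq_of_finrank_symm E hF.le P hP hPE hPsymm
  let E' := E.map swapFactors.toLinearMap
  have hE' : finrank ℝ E' = 6 := by rw [← hE]; exact swapFactors.finrank_map_eq E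
  have hker' : LinearMap.ker tracelessPart ≤ E' := by
    intro m hm
    refine ⟨swapFactors m, hker ?_, rfl⟩
    rw [LinearMap.mem_ker] at hm ⊢
    ext u ⟨s, w⟩
    rw [tracelessPart_swapFactors, hm]
    rfl
  let σ : (Fin 2 × Fin 2 → (Fin 2 × Fin 2) × (Fin 2 × Fin 2) → ℝ) ≃ₗ[ℝ]
      (Fin 2 × Fin 2 → (Fin 2 × Fin 2) × (Fin 2 × Fin 2) → ℝ) :=
    LinearEquiv.funCongrLeft ℝ _ (Equiv.prodComm _ _) ≪≫ₗ
      LinearEquiv.piCongrRight fun _ => swapFactors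
  have hσ : ∀ Y a, σ Y a = swapFactors (Y a.swap) := fun _ _ => rfl
  obtain ⟨h, hh⟩ := exists_tracelessPart_eq_of_finrank_symm E'
    (finrank_map_tracelessPart E' hE' hker').le (Q.map σ.toLinearMap)
    (hQ.trans (σ.finrank_map_eq Q).ge)
    (by
      rintro _ ⟨Y, hY, rfl⟩ a
      exact ⟨_, hQE Y hY a.swap, rfl⟩)
    (by
      rintro _ ⟨Y, hY, rfl⟩ a a' b
      exact hQsymm Y hY _ _ _)
  refine finrank_ne_two_of_forall_eq_mul (E.map tracelessPart) g ?_ (fun u s => h (s.rev, u)) ?_ hF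
  · rintro _ ⟨m, hm, rfl⟩
    exact hg m hm
  · rintro _ ⟨m, hm, rfl⟩
    obtain ⟨β, hβ⟩ := hh _ (mem_map_of_mem hm)
    refine ⟨β, fun u s w => ?_⟩
    rw [← hβ]
    simpa using (tracelessPart_swapFactors m w u s.rev).symm

end TracelessPart

section Frames

open Module Submodule

variable {ι : Type*} {n : ℕ}

/-- The families of `n` vectors of `ℝ^ι` that are orthonormal for the dot product. -/
def orthonormalFrames (ι : Type*) [Fintype ι] (n : ℕ) : Set (Fin n → ι → ℝ) :=
  {v | ∀ i j, v i ⬝ᵥ v j = if i = j then 1 else 0}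

/-- The orthogonal projection onto the span of an orthonormal frame. -/
def frameProj [Fintype ι] (v : Fin n → ι → ℝ) (t : ι → ℝ) : ι → ℝ := ∑ i, (v i ⬝ᵥ t) • v i

variable [Fintype ι]

theorem isClosed_orthonormalFrames : IsClosed (orthonormalFrames ι n) := by
  simp only [orthonormalFrames, Set.ofPred_forall]
  refine isClosed_iInter fun i => isClosed_iInter fun j => isClosed_eq ?_ continuous_const
  simp only [dotProduct]
  fun_prop

theorem isCompact_orthonormalFrames : IsCompact (orthonormalFrames ι n) := by
  refine Metric.isCompact_of_isClosed_isBounded isClosed_orthonormalFrames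
    (Metric.isBounded_closedBall.subset (t := Metric.closedBall 0 1) fun v hv => ?_)
  rw [mem_closedBall_zero_iff, pi_norm_le_iff_of_nonneg zero_le_one]
  intro i
  rw [pi_norm_le_iff_of_nonneg zero_le_one]
  intro k
  rw [Real.norm_eq_abs, ← sq_le_one_iff_abs_le_one]
  have h : ∑ k, v i k * v i k = 1 := by simpa [dotProduct] using hv i i
  rw [← h, sq]
  exact Finset.single_le_sum (f := fun k => v i k * v i k) (fun k _ => mul_self_nonneg _)
    (Finset.mem_univ k)

theorem exists_orthonormalFrame_span_eq {w : Fin n → ι → ℝ} (hw : LinearIndependent ℝ w) :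
    ∃ v ∈ orthonormalFrames ι n, span ℝ (Set.range v) = span ℝ (Set.range w) := by
  let e := (WithLp.linearEquiv 2 ℝ (ι → ℝ)).symm
  have hw' : LinearIndependent ℝ (e ∘ w) := hw.map' e.toLinearMap e.ker
  have ho := InnerProductSpace.gramSchmidtNormed_orthonormal (𝕜 := ℝ) hw'
  refine ⟨fun i => e.symm (InnerProductSpace.gramSchmidtNormed ℝ (e ∘ w) i), fun i j => ?_, ?_⟩
  · rw [← orthonormal_iff_ite.1 ho i j, dotProduct_comm]
    rfl
  · have h := InnerProductSpace.span_gramSchmidtNormed_range (𝕜 := ℝ) (e ∘ w)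
    rw [InnerProductSpace.span_gramSchmidt] at h
    have h' := congrArg (Submodule.map e.symm.toLinearMap) h
    rw [map_span, map_span, ← Set.range_comp, ← Set.range_comp] at h'
    exact h'

theorem dotProduct_frameProj {v : Fin n → ι → ℝ} (hv : v ∈ orthonormalFrames ι n) (t : ι → ℝ)
    (i : Fin n) : v i ⬝ᵥ frameProj v t = v i ⬝ᵥ t := by
  simp [frameProj, dotProduct_sum, hv i]

theorem linearIndependent_of_mem_orthonormalFrames {v : Fin n → ι → ℝ}
    (hv : v ∈ orthonormalFrames ι n) : LinearIndependent ℝ v := by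
  rw [Fintype.linearIndependent_iff]
  intro c hc i
  have h := congrArg (v i ⬝ᵥ ·) hc
  simpa [dotProduct_sum, hv i] using h

theorem frameProj_mem_span (v : Fin n → ι → ℝ) (t : ι → ℝ) :
    frameProj v t ∈ span ℝ (Set.range v) :=
  sum_mem fun i _ => smul_mem _ _ (subset_span (Set.mem_range_self i))

theorem frameProj_eq_self {v : Fin n → ι → ℝ} (hv : v ∈ orthonormalFrames ι n) {t : ι → ℝ}
    (ht : t ∈ span ℝ (Set.range v)) : frameProj v t = t := by
  obtain ⟨c, rfl⟩ := (mem_span_range_iff_exists_fun ℝ).1 ht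
  simp [frameProj, dotProduct_sum, hv _]

theorem sum_sq_sub_frameProj_le {v : Fin n → ι → ℝ} (hv : v ∈ orthonormalFrames ι n)
    {s : ι → ℝ} (hs : s ∈ span ℝ (Set.range v)) (t : ι → ℝ) :
    ∑ k, (t k - frameProj v t k) ^ 2 ≤ ∑ k, (t k - s k) ^ 2 := by
  set r := t - frameProj v t with hr
  have hort : ∀ i, v i ⬝ᵥ r = 0 := fun i => by
    rw [hr, dotProduct_sub, dotProduct_frameProj hv, sub_self]
  have hmem := (mem_span_range_iff_exists_fun ℝ).1 (sub_mem (frameProj_mem_span v t) hs)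
  obtain ⟨c, hc⟩ := hmem
  have hrc : (frameProj v t - s) ⬝ᵥ r = 0 := by
    simp [← hc, sum_dotProduct, hort]
  have hsq : ∀ f : ι → ℝ, ∑ k, f k ^ 2 = f ⬝ᵥ f := fun f => by simp [dotProduct, sq]
  have hdec : t - s = r + (frameProj v t - s) := by rw [hr]; abel
  change ∑ k, r k ^ 2 ≤ ∑ k, (t - s) k ^ 2
  rw [hdec, hsq r, hsq, add_dotProduct, dotProduct_add, dotProduct_add,
    dotProduct_comm r (frameProj v t - s), hrc, ← hsq (frameProj v t - s)]
  have := Finset.sum_nonneg fun k (_ : k ∈ Finset.univ) => sq_nonneg ((frameProj v t - s) k)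
  linarith

theorem Continuous.frameProj {α : Type*} [TopologicalSpace α] {f : α → Fin n → ι → ℝ}
    {g : α → ι → ℝ} (hf : Continuous f) (hg : Continuous g) :
    Continuous fun x => frameProj (f x) (g x) := by
  simp only [_root_.frameProj, dotProduct]
  fun_prop

end Frames

section Spanning

open Module Submodule

/-- Finitely many elements of a spanning set lie in the span of equally many linearly independent
elements of that set. -/
theorem exists_linearIndependent_span_le {V : Type*} [AddCommGroup V] [Module ℝ V]
    [FiniteDimensional ℝ V] {t : Set V} (ht : span ℝ t = ⊤) {n : ℕ} (hn : n ≤ finrank ℝ V)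
    (r : Fin n → V) (hr : ∀ j, r j ∈ t) :
    ∃ w : Fin n → V, LinearIndependent ℝ w ∧ (∀ j, w j ∈ t) ∧
      span ℝ (Set.range r) ≤ span ℝ (Set.range w) := by
  classical
  obtain ⟨b, hbr, hspan, hb⟩ := exists_linearIndependent ℝ (Set.range r)
  obtain ⟨c, hct, hbc, htc, hc⟩ := exists_linearIndepOn_extension (v := id) hb
    (hbr.trans (Set.range_subset_iff.2 hr))
  have hcfin : c.Finite := hc.linearIndependent.setFinite
  have hbfin : b.Finite := hcfin.subset hbc
  have hccard : n ≤ hcfin.toFinset.card := by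
    have h : span ℝ c = ⊤ := by
      rw [eq_top_iff, ← ht, span_le]
      simpa using htc
    have : Fintype c := hcfin.fintype
    have h' := finrank_span_set_eq_card (R := ℝ) (s := c) hc
    rw [h, finrank_top] at h'
    rwa [h', ← Set.Finite.toFinset_eq_toFinset hcfin] at hn
  have hbcard : hbfin.toFinset.card ≤ n := by
    have h1 : hbfin.toFinset ⊆ Finset.univ.image r := by
      intro x hx
      simpa using hbr (by simpa using hx)
    exact (Finset.card_le_card h1).trans (Finset.card_image_le.trans (by simp))
  obtain ⟨d, hbd, hdc, hd⟩ := Finset.exists_subsuperset_card_eq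
    (by simpa using hbc : hbfin.toFinset ⊆ hcfin.toFinset) hbcard hccard
  have hdc' : (d : Set V) ⊆ c := by simpa using hdc
  have hbd' : b ⊆ (d : Set V) := by simpa using hbd
  let e := (d.equivFinOfCardEq hd).symm
  have hrange : Set.range (fun j => (e j : V)) = d := by
    ext x
    refine ⟨?_, fun hx => ⟨e.symm ⟨x, hx⟩, by simp⟩⟩
    rintro ⟨j, rfl⟩
    exact (e j).2
  refine ⟨fun j => e j, ?_, fun j => hct (hdc' (e j).2), ?_⟩
  · have hdi : LinearIndependent ℝ (fun x : d => (x : V)) := hc.mono hdc'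
    exact hdi.comp e e.injective
  · rw [hrange, ← hspan]
    exact span_mono hbd'

theorem span_rankOne_eq_top (ι κ : Type*) [Fintype ι] [Fintype κ] :
    span ℝ {m : ι × κ → ℝ | ∃ (a : ι → ℝ) (b : κ → ℝ), m = fun p => a p.1 * b p.2} = ⊤ := by
  classical
  rw [eq_top_iff, ← (Pi.basisFun ℝ (ι × κ)).span_eq, span_le]
  rintro _ ⟨⟨i, k⟩, rfl⟩
  refine subset_span ⟨Pi.single i 1, Pi.single k 1, ?_⟩
  ext ⟨i', k'⟩
  simp only [Pi.basisFun_apply, Pi.single_apply, Prod.ext_iff]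
  split_ifs <;> simp_all

theorem linearIndependent_mul {ι κ σ : Type*} [Fintype σ] {w : σ → κ → ℝ}
    (hw : LinearIndependent ℝ w) {f : σ → ι → ℝ} (hf : ∀ j, f j ≠ 0) :
    LinearIndependent ℝ fun j (p : ι × κ) => f j p.1 * w j p.2 := by
  rw [Fintype.linearIndependent_iff] at hw ⊢
  intro c hc j
  obtain ⟨i, hi⟩ := Function.ne_iff.1 (hf j)
  have := hw (fun j => c j * f j i) (by
    ext k
    simpa [mul_assoc] using congrFun hc (i, k)) j
  exact (mul_eq_zero.1 this).resolve_right hi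

end Spanning

section Compactness

open Module Submodule

/-- The compact set of triples consisting of an orthonormal basis of a six-dimensional
`E ⊆ A ⊗ B`, six orthonormal elements of `(A ⊗ E) ∩ (S²A ⊗ B)`, and six orthonormal elements of
`(B ⊗ E) ∩ (A ⊗ S²B)`. -/
def symmFrames : Set ((Fin 6 → (Fin 2 × Fin 2) × (Fin 2 × Fin 2) → ℝ) ×
    (Fin 6 → (Fin 2 × Fin 2) × ((Fin 2 × Fin 2) × (Fin 2 × Fin 2)) → ℝ) ×
    (Fin 6 → (Fin 2 × Fin 2) × ((Fin 2 × Fin 2) × (Fin 2 × Fin 2)) → ℝ)) :=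
  {q | (∀ j a, frameProj q.1 (fun p => q.2.1 j (a, p)) = fun p => q.2.1 j (a, p)) ∧
      (∀ j b, frameProj q.1 (fun p => q.2.2 j (b, p)) = fun p => q.2.2 j (b, p)) ∧
      (∀ j a a' b, q.2.1 j (a, (a', b)) = q.2.1 j (a', (a, b))) ∧
      (∀ j a b b', q.2.2 j (b, (a, b')) = q.2.2 j (b', (a, b)))} ∩
    orthonormalFrames _ 6 ×ˢ orthonormalFrames _ 6 ×ˢ orthonormalFrames _ 6

theorem isCompact_symmFrames : IsCompact symmFrames := by
  refine (isCompact_orthonormalFrames.prod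
    (isCompact_orthonormalFrames.prod isCompact_orthonormalFrames)).inter_left ?_
  simp only [Set.ofPred_and, Set.ofPred_forall]
  refine .inter ?_ (.inter ?_ (.inter ?_ ?_))
  · exact isClosed_iInter fun j => isClosed_iInter fun a =>
      isClosed_eq (continuous_fst.frameProj (by fun_prop)) (by fun_prop)
  · exact isClosed_iInter fun j => isClosed_iInter fun a =>
      isClosed_eq (continuous_fst.frameProj (by fun_prop)) (by fun_prop)
  · exact isClosed_iInter fun j => isClosed_iInter fun a => isClosed_iInter fun a' =>
      isClosed_iInter fun b => isClosed_eq (by fun_prop) (by fun_prop)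
  · exact isClosed_iInter fun j => isClosed_iInter fun a => isClosed_iInter fun b =>
      isClosed_iInter fun b' => isClosed_eq (by fun_prop) (by fun_prop)

/-- The squared distance from the slices of `M₂` to the span of an orthonormal frame. -/
def sliceError (v : Fin 6 → (Fin 2 × Fin 2) × (Fin 2 × Fin 2) → ℝ) : ℝ :=
  ∑ i : Fin 2 × Fin 2, ∑ p : (Fin 2 × Fin 2) × (Fin 2 × Fin 2),
    (matMulTensor 2 i p.1 p.2 - frameProj v (fun p => matMulTensor 2 i p.1 p.2) p) ^ 2

theorem continuous_sliceError : Continuous sliceError := by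
  unfold sliceError
  refine continuous_finsetSum _ fun i _ => continuous_finsetSum _ fun p _ => ?_
  refine (continuous_const.sub ?_).pow 2
  exact (continuous_apply p).comp (continuous_id.frameProj continuous_const)

theorem finrank_span_curry {ι κ : Type*} [Fintype ι] [Fintype κ] {n : ℕ}
    {x : Fin n → ι × κ → ℝ} (hx : LinearIndependent ℝ x) :
    finrank ℝ (span ℝ (Set.range fun j i k => x j (i, k))) = n := by
  have h : LinearIndependent ℝ fun j i k => x j (i, k) :=
    hx.map' (LinearEquiv.curry ℝ ℝ ι κ).toLinearMap (LinearEquiv.ker _)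
  simpa using finrank_span_eq_card h

theorem sliceError_pos {q} (hq : q ∈ symmFrames) : 0 < sliceError q.1 := by
  obtain ⟨⟨hxE, hyE, hxs, hys⟩, hv, hx, hy⟩ := hq
  have h0 : 0 ≤ sliceError q.1 :=
    Finset.sum_nonneg fun i _ => Finset.sum_nonneg fun p _ => sq_nonneg _
  refine h0.lt_of_ne fun h => ?_
  have hT : ∀ i, (fun p => matMulTensor 2 i p.1 p.2) ∈ span ℝ (Set.range q.1) := by
    intro i
    have h1 := (Finset.sum_eq_zero_iff_of_nonneg fun i _ =>
      Finset.sum_nonneg fun p _ => sq_nonneg _).1 h.symm i (Finset.mem_univ i)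
    have h2 : frameProj q.1 (fun p => matMulTensor 2 i p.1 p.2) =
        fun p => matMulTensor 2 i p.1 p.2 := by
      ext p
      have h3 := (Finset.sum_eq_zero_iff_of_nonneg fun p _ => sq_nonneg _).1 h1 p
        (Finset.mem_univ p)
      exact (sub_eq_zero.1 (pow_eq_zero_iff two_ne_zero |>.1 h3)).symm
    rw [← h2]
    exact frameProj_mem_span _ _
  have hE := finrank_span_eq_card (linearIndependent_of_mem_orthonormalFrames hv)
  rw [Fintype.card_fin] at hE
  refine not_six_le_finrank_symm _ hE hT
    _ (finrank_span_curry (linearIndependent_of_mem_orthonormalFrames hx)).ge ?_ ?_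
    _ (finrank_span_curry (linearIndependent_of_mem_orthonormalFrames hy)).ge ?_ ?_
  · intro X hX a
    induction hX using span_induction with
    | mem X hX =>
      obtain ⟨j, rfl⟩ := hX
      change (fun p => q.2.1 j (a, p)) ∈ _
      rw [← hxE j a]
      exact frameProj_mem_span _ _
    | zero => exact zero_mem _
    | add X Y _ _ h h' => exact add_mem h h'
    | smul c X _ h => exact smul_mem _ c h
  · intro X hX a a' b
    induction hX using span_induction with
    | mem X hX =>
      obtain ⟨j, rfl⟩ := hX
      exact hxs j a a' b
    | zero => rfl
    | add X Y _ _ h h' => simp [h, h']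
    | smul c X _ h => simp [h]
  · intro Y hY b
    induction hY using span_induction with
    | mem Y hY =>
      obtain ⟨j, rfl⟩ := hY
      change (fun p => q.2.2 j (b, p)) ∈ _
      rw [← hyE j b]
      exact frameProj_mem_span _ _
    | zero => exact zero_mem _
    | add X Y _ _ h h' => exact add_mem h h'
    | smul c X _ h => exact smul_mem _ c h
  · intro Y hY a b b'
    induction hY using span_induction with
    | mem Y hY =>
      obtain ⟨j, rfl⟩ := hY
      exact hys j a b b'
    | zero => rfl
    | add X Y _ _ h h' => simp [h, h']
    | smul c X _ h => simp [h]

/-- The span of six linearly independent rank-one matrices underlies an element of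
`symmFrames`. -/
theorem exists_mem_symmFrames (a b : Fin 6 → Fin 2 × Fin 2 → ℝ)
    (hw : LinearIndependent ℝ
      fun j (p : (Fin 2 × Fin 2) × (Fin 2 × Fin 2)) => a j p.1 * b j p.2) :
    ∃ q ∈ symmFrames, span ℝ (Set.range q.1) = span ℝ (Set.range
      fun j (p : (Fin 2 × Fin 2) × (Fin 2 × Fin 2)) => a j p.1 * b j p.2) := by
  have ha : ∀ j, a j ≠ 0 := fun j h => hw.ne_zero j (by ext; simp [h])
  have hb : ∀ j, b j ≠ 0 := fun j h => hw.ne_zero j (by ext; simp [h])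
  obtain ⟨v, hv, hvs⟩ := exists_orthonormalFrame_span_eq hw
  obtain ⟨x, hx, hxs⟩ := exists_orthonormalFrame_span_eq (linearIndependent_mul hw ha)
  obtain ⟨y, hy, hys⟩ := exists_orthonormalFrame_span_eq (linearIndependent_mul hw hb)
  have hx' := fun j => hxs.le (subset_span (Set.mem_range_self j))
  have hy' := fun j => hys.le (subset_span (Set.mem_range_self j))
  have hmem : ∀ j, (fun p : (Fin 2 × Fin 2) × (Fin 2 × Fin 2) => a j p.1 * b j p.2) ∈
      span ℝ (Set.range v) := fun j => hvs.ge (subset_span (Set.mem_range_self j))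
  have hslice : ∀ (f : Fin 6 → Fin 2 × Fin 2 → ℝ), ∀ z ∈ span ℝ (Set.range
      fun j (p : (Fin 2 × Fin 2) × ((Fin 2 × Fin 2) × (Fin 2 × Fin 2))) =>
        f j p.1 * (a j p.2.1 * b j p.2.2)),
      ∀ i, (fun p => z (i, p)) ∈ span ℝ (Set.range v) := by
    intro f z hz i
    induction hz using span_induction with
    | mem z hz =>
      obtain ⟨j, rfl⟩ := hz
      exact smul_mem _ (f j i) (hmem j)
    | zero => exact zero_mem _
    | add X Y _ _ h h' => exact add_mem h h'
    | smul c X _ h => exact smul_mem _ c h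
  refine ⟨(v, x, y), ⟨⟨?_, ?_, ?_, ?_⟩, hv, hx, hy⟩, hvs⟩
  · exact fun j i => frameProj_eq_self hv (hslice a _ (hx' j) i)
  · exact fun j i => frameProj_eq_self hv (hslice b _ (hy' j) i)
  · intro j i i' k
    change x j (i, (i', k)) = x j (i', (i, k))
    have h := hx' j
    generalize x j = z at h ⊢
    induction h using span_induction with
    | mem z hz =>
      obtain ⟨j, rfl⟩ := hz
      exact mul_left_comm _ _ _
    | zero => rfl
    | add X Y _ _ h h' => simp [h, h']
    | smul c X _ h => simp [h]
  · intro j i k k'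
    change y j (k, (i, k')) = y j (k', (i, k))
    have h := hy' j
    generalize y j = z at h ⊢
    induction h using span_induction with
    | mem z hz =>
      obtain ⟨j, rfl⟩ := hz
      change b j k * (a j i * b j k') = b j k' * (a j i * b j k)
      ring
    | zero => rfl
    | add X Y _ _ h h' => simp [h, h']
    | smul c X _ h => simp [h]

end Compactness

/-- The border rank of `M₂` equals its rank: the squared error of any rank-6
approximation of the 2×2 matrix multiplication tensor is bounded away from zero. -/
theorem M2_no_rank_six_border_approximation :
    ∃ δ : ℝ, 0 < δ ∧
      ∀ (Wa Wb : Matrix (Fin 6) (Fin 2 × Fin 2) ℝ)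
        (Wc : Matrix (Fin 2 × Fin 2) (Fin 6) ℝ),
        δ ≤ ∑ i : Fin 2 × Fin 2, ∑ k : Fin 2 × Fin 2, ∑ l : Fin 2 × Fin 2,
              (matMulTensor 2 i k l - ∑ j, Wc i j * Wa j k * Wb j l) ^ 2 := by
  obtain ⟨δ, hδ, hmin⟩ := isCompact_symmFrames.exists_forall_le'
    (continuous_sliceError.comp continuous_fst).continuousOn fun q hq => sliceError_pos hq
  refine ⟨δ, hδ, fun Wa Wb Wc => ?_⟩
  obtain ⟨w, hw, hrank, hle⟩ := exists_linearIndependent_span_le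
    (span_rankOne_eq_top (Fin 2 × Fin 2) (Fin 2 × Fin 2)) (n := 6) (by simp)
    (fun j p => Wa j p.1 * Wb j p.2) (fun j => ⟨Wa j, Wb j, rfl⟩)
  choose a b hab using hrank
  obtain rfl : w = fun j p => a j p.1 * b j p.2 := funext hab
  obtain ⟨q, hq, hqs⟩ := exists_mem_symmFrames a b hw
  refine (show δ ≤ sliceError q.1 from hmin q hq).trans (Finset.sum_le_sum fun i _ => ?_)
  rw [← Fintype.sum_prod_type' fun k l =>
    (matMulTensor 2 i k l - ∑ j, Wc i j * Wa j k * Wb j l) ^ 2]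
  refine sum_sq_sub_frameProj_le hq.2.1 (s := fun p => ∑ j, Wc i j * Wa j p.1 * Wb j p.2) ?_ _
  rw [hqs]
  refine hle ((Submodule.mem_span_range_iff_exists_fun ℝ).2 ⟨Wc i, ?_⟩)
  ext p
  simp [mul_assoc]
end

section
/- (Schönhage; border approximations of M₃) For every ε > 0 there exist matrices W_a, W_b ∈ ℝ^{22×9} and W_c ∈ ℝ^{9×22} such that Σ_{i,k,l=1}^{9} ( M₃(i,k,l) − Σ_{j=1}^{22} W_c(i,j) W_a(j,k) W_b(j,l) )² < ε. That is, the 3×3 matrix multiplication tensor admits rank-22 border approximations: its border rank is at most 22. -/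
open Matrix

/-- Index type of the products in Schönhage's approximate algorithm, padded to 22 elements. -/
abbrev ProductIndex : Type := (Fin 3 × Fin 3) ⊕ (Fin 3 × Fin 3) ⊕ Fin 3 ⊕ Unit

/-- The linear forms in the entries of the left factor. -/
def leftForm (t : ℝ) (a : Fin 3 → Fin 3 → ℝ) : ProductIndex → ℝ
  | .inl (i, j) => a i 0 + t ^ 2 * a j 1
  | .inr (.inl (i, j)) => a i 0 + t ^ 2 * a j 2
  | .inr (.inr (.inl i)) => a i 0
  | .inr (.inr (.inr _)) => 0

/-- The linear forms in the entries of the right factor. -/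
def rightForm (t : ℝ) (b : Fin 3 → Fin 3 → ℝ) : ProductIndex → ℝ
  | .inl (i, j) => b 1 i + if i = j then 0 else t * b 0 j
  | .inr (.inl (i, j)) => b 2 i + if i = j then t ^ 2 * b 0 i else -(t * b 0 j)
  | .inr (.inr (.inl i)) => b 1 i + b 2 i
  | .inr (.inr (.inr _)) => 0

/-- The coefficients with which the products enter the `(p, q)` entry of the matrix product. -/
noncomputable def outputCoeff (t : ℝ) (p q : Fin 3) : ProductIndex → ℝ
  | .inl (i, j) => (if i = q ∧ j = p then (t ^ 2)⁻¹ else 0) +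
      (if p ≠ q ∧ i = p ∧ j = q then t⁻¹ else 0) - (if p ≠ q ∧ i = p ∧ j = p then t⁻¹ else 0)
  | .inr (.inl (i, j)) => if i = q ∧ j = p then (t ^ 2)⁻¹ else 0
  | .inr (.inr (.inl i)) => if i = q then -(t ^ 2)⁻¹ else 0
  | .inr (.inr (.inr _)) => 0

/-- The error in the `(p, q)` entry, divided by `t`. -/
def errorForm (t : ℝ) (a b : Fin 3 → Fin 3 → ℝ) (p q : Fin 3) : ℝ :=
  if p = q then t * a p 2 * b 0 p
  else (a p 1 - a p 2) * b 0 p + (a q 1 - a p 1) * b 1 p + t * a q 1 * b 0 q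

theorem sum_outputCoeff_mul {t : ℝ} (ht : t ≠ 0) (a b : Fin 3 → Fin 3 → ℝ) (p q : Fin 3) :
    ∑ j, outputCoeff t p q j * leftForm t a j * rightForm t b j =
      ∑ k, a p k * b k q + t * errorForm t a b p q := by
  simp only [Fintype.sum_sum_type, Fintype.sum_prod_type, Fin.sum_univ_three]
  fin_cases p <;> fin_cases q <;>
    · simp [outputCoeff, leftForm, rightForm, errorForm]
      field_simp
      ring

/-- The matrix unit at position `k`. -/
def matrixUnit (k : Fin 3 × Fin 3) : Fin 3 → Fin 3 → ℝ :=
  fun p q => if k = (p, q) then 1 else 0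

theorem sum_matrixUnit_mul (i k l : Fin 3 × Fin 3) :
    ∑ m, matrixUnit k i.1 m * matrixUnit l m i.2 = matMulTensor 3 i k l := by
  obtain ⟨i, i'⟩ := i
  obtain ⟨k, k'⟩ := k
  obtain ⟨l, l'⟩ := l
  simp only [matrixUnit, matMulTensor, Prod.mk.injEq, mul_ite, mul_one, mul_zero]
  rw [Finset.sum_eq_single l (by grind) (by simp)]
  grind

/-- Schönhage: the 3×3 matrix multiplication tensor admits rank-22 border
approximations; its border rank is at most 22. -/
theorem M3_rank_22_border_approximations :
    ∀ ε : ℝ, 0 < ε →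
      ∃ (Wa Wb : Matrix (Fin 22) (Fin 3 × Fin 3) ℝ)
        (Wc : Matrix (Fin 3 × Fin 3) (Fin 22) ℝ),
        (∑ i : Fin 3 × Fin 3, ∑ k : Fin 3 × Fin 3, ∑ l : Fin 3 × Fin 3,
            (matMulTensor 3 i k l - ∑ j, Wc i j * Wa j k * Wb j l) ^ 2) < ε := by
  intro ε hε
  have hlim : Filter.Tendsto (fun t : ℝ => ∑ i : Fin 3 × Fin 3, ∑ k, ∑ l,
      (t * errorForm t (matrixUnit k) (matrixUnit l) i.1 i.2) ^ 2)
      (nhdsWithin 0 {0}ᶜ) (nhds 0) := by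
    have hcont : Continuous (fun t : ℝ => ∑ i : Fin 3 × Fin 3, ∑ k, ∑ l,
        (t * errorForm t (matrixUnit k) (matrixUnit l) i.1 i.2) ^ 2) := by
      refine continuous_finsetSum _ fun i _ => continuous_finsetSum _ fun k _ =>
        continuous_finsetSum _ fun l _ => ?_
      unfold errorForm
      split_ifs <;> fun_prop
    simpa using (hcont.tendsto 0).mono_left nhdsWithin_le_nhds
  obtain ⟨t, hlt, ht⟩ := ((hlim.eventually_lt_const hε).and self_mem_nhdsWithin).exists
  let e : Fin 22 ≃ ProductIndex := (Fintype.equivFinOfCardEq (by simp)).symm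
  refine ⟨fun j k => leftForm t (matrixUnit k) (e j), fun j l => rightForm t (matrixUnit l) (e j),
    fun i j => outputCoeff t i.1 i.2 (e j), lt_of_eq_of_lt ?_ hlt⟩
  refine Finset.sum_congr rfl fun i _ => Finset.sum_congr rfl fun k _ =>
    Finset.sum_congr rfl fun l _ => ?_
  rw [e.sum_comp fun j => outputCoeff t i.1 i.2 j * leftForm t (matrixUnit k) j *
    rightForm t (matrixUnit l) j, sum_outputCoeff_mul ht, sum_matrixUnit_mul]
  ring
end
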